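/- Let A₁ = ℂ[x,y,t]/(t(x² + y⁵) − 1) and A₃ = ℂ[x,y,t]/(t³(x² + y⁵) − 1). Then the ℂ-algebras A₁ and A₃ are not isomorphic, but the Laurent polynomial rings A₁[u,u⁻¹] and A₃[u,u⁻¹] (i.e. LaurentPolynomial A₁ and LaurentPolynomial A₃) are isomorphic as ℂ-algebras. -/

import Mathlib

/-- `A_ℓ = ℂ[x,y,t]/(t^ℓ(x² + y⁵) - 1)`, the coordinate ring of the surface
`X_ℓ ⊂ 𝔸³` defined by `t^ℓ(x² + y⁵) = 1`. -/
noncomputable abbrev surfaceRing25 (ℓ : ℕ) : Type :=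
  MvPolynomial (Fin 3) ℂ ⧸ Ideal.span
    {(MvPolynomial.X 2 : MvPolynomial (Fin 3) ℂ) ^ ℓ *
      ((MvPolynomial.X 0) ^ 2 + (MvPolynomial.X 1) ^ 5) - 1}

namespace LaurentPolynomial

open scoped LaurentPolynomial

variable {R A S : Type*} [CommSemiring R] [CommSemiring A] [CommSemiring S] [Algebra R A]
  [Algebra R S]

/-- The algebra homomorphism out of a Laurent polynomial ring determined by its restriction to the
coefficients and by the image of the variable. -/
noncomputable def liftAlgHom (f : A →ₐ[R] S) (u : Sˣ) : A[T;T⁻¹] →ₐ[R] S :=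
  { eval₂ f.toRingHom u with
    commutes' := fun r => by
      simp only [algebraMap_apply]
      exact (eval₂_C f.toRingHom u _).trans (f.commutes r) }

theorem liftAlgHom_C (f : A →ₐ[R] S) (u : Sˣ) (a : A) : liftAlgHom f u (C a) = f a :=
  eval₂_C f.toRingHom u a

theorem liftAlgHom_T_one (f : A →ₐ[R] S) (u : Sˣ) : liftAlgHom f u (T 1) = u :=
  (eval₂_T f.toRingHom u 1).trans (by simp)

theorem liftAlgHom_T_neg_one (f : A →ₐ[R] S) (u : Sˣ) :
    liftAlgHom f u (T (-1)) = (u⁻¹ : Sˣ) :=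
  (eval₂_T f.toRingHom u (-1)).trans (by simp)

theorem T_one_mul_T_neg_one : (T 1 * T (-1) : A[T;T⁻¹]) = 1 := by
  rw [← T_add]; simp

theorem algHom_ext_of_C_of_T {f g : A[T;T⁻¹] →ₐ[R] S} (hC : ∀ a, f (C a) = g (C a))
    (hT : f (T 1) = g (T 1)) : f = g := by
  have hT' : f (T (-1)) = g (T (-1)) := by
    have h1 : f (T 1) * f (T (-1)) = 1 := by rw [← map_mul, T_one_mul_T_neg_one, map_one]
    have h2 : g (T 1) * g (T (-1)) = 1 := by rw [← map_mul, T_one_mul_T_neg_one, map_one]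
    calc f (T (-1)) = (g (T 1) * g (T (-1))) * f (T (-1)) := by rw [h2, one_mul]
      _ = (f (T 1) * f (T (-1))) * g (T (-1)) := by rw [hT]; ring
      _ = g (T (-1)) := by rw [h1, one_mul]
  refine AlgHom.ext fun p => ?_
  induction p using LaurentPolynomial.induction_on with
  | h_C a => exact hC a
  | h_add hp hq => rw [map_add, map_add, hp, hq]
  | h_C_mul_T n a h =>
    rw [T_add, ← mul_assoc, map_mul, h, hT, map_mul g (_ * _)]
  | h_C_mul_T_Z n a h =>
    rw [sub_eq_add_neg, T_add, ← mul_assoc, map_mul, h, hT', map_mul g (_ * _)]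

end LaurentPolynomial

/-- The `ℂ`-algebra `A` with its elements `x`, `y`, `t` is the universal solution of
`t^ℓ(x² + y⁵) = 1`. -/
structure IsUniversalSolution (ℓ : ℕ) {A : Type} [CommRing A] [Algebra ℂ A] (x y t : A) :
    Prop where
  rel : t ^ ℓ * (x ^ 2 + y ^ 5) = 1
  exists_lift : ∀ {S : Type} [CommRing S] [Algebra ℂ S] (a b c : S),
    c ^ ℓ * (a ^ 2 + b ^ 5) = 1 → ∃ f : A →ₐ[ℂ] S, f x = a ∧ f y = b ∧ f t = c
  hom_ext : ∀ {S : Type} [CommRing S] [Algebra ℂ S] {f g : A →ₐ[ℂ] S},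
    f x = g x → f y = g y → f t = g t → f = g

theorem surfaceRing25_isUniversalSolution (ℓ : ℕ) :
    IsUniversalSolution ℓ (A := surfaceRing25 ℓ) (Ideal.Quotient.mk _ (MvPolynomial.X 0))
      (Ideal.Quotient.mk _ (MvPolynomial.X 1)) (Ideal.Quotient.mk _ (MvPolynomial.X 2)) where
  rel := by
    have h : (Ideal.Quotient.mk (Ideal.span {(MvPolynomial.X 2 : MvPolynomial (Fin 3) ℂ) ^ ℓ *
        ((MvPolynomial.X 0) ^ 2 + (MvPolynomial.X 1) ^ 5) - 1}))
        ((MvPolynomial.X 2 : MvPolynomial (Fin 3) ℂ) ^ ℓ *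
        ((MvPolynomial.X 0) ^ 2 + (MvPolynomial.X 1) ^ 5) - 1) = 0 :=
      Ideal.Quotient.eq_zero_iff_mem.2 (Ideal.subset_span rfl)
    rw [map_sub, map_mul, map_pow, map_add, map_pow, map_pow, map_one, sub_eq_zero] at h
    exact h
  exists_lift a b c h :=
    ⟨Ideal.Quotient.liftₐ _ (MvPolynomial.aeval ![a, b, c]) fun p hp => by
        refine (Ideal.span_le (I := RingHom.ker (MvPolynomial.aeval (R := ℂ) ![a, b, c]))).2 ?_ hp
        simp [h],
      MvPolynomial.aeval_X ![a, b, c] 0, MvPolynomial.aeval_X ![a, b, c] 1,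
      MvPolynomial.aeval_X ![a, b, c] 2⟩
  hom_ext hx hy ht := by
    refine Ideal.Quotient.algHom_ext _ (MvPolynomial.algHom_ext fun i => ?_)
    fin_cases i
    exacts [hx, hy, ht]

namespace IsUniversalSolution

section Laurent

open LaurentPolynomial
open scoped LaurentPolynomial

variable {A B S : Type} [CommRing A] [Algebra ℂ A] [CommRing B] [Algebra ℂ B] [CommRing S]
  [Algebra ℂ S]

theorem laurent_algHom_ext {ℓ : ℕ} {x y t : A} (hA : IsUniversalSolution ℓ x y t)
    {f g : A[T;T⁻¹] →ₐ[ℂ] S} (hx : f (C x) = g (C x)) (hy : f (C y) = g (C y))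
    (ht : f (C t) = g (C t)) (hT : f (T 1) = g (T 1)) : f = g := by
  let ι : A →ₐ[ℂ] A[T;T⁻¹] := Algebra.algHom ℂ _ _
  have h : f.comp ι = g.comp ι := hA.hom_ext hx hy ht
  exact algHom_ext_of_C_of_T (fun a => DFunLike.congr_fun h a) hT

/-- The cylinders are isomorphic through the change of coordinates `t³u¹⁰`, `t²u⁷` on the torus
with coordinates `t`, `u`; the exponents form a matrix of determinant `3 * 7 - 10 * 2 = 1`. -/
theorem nonempty_laurent_algEquiv {x y t : A} {x' y' t' : B} (hA : IsUniversalSolution 1 x y t)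
    (hB : IsUniversalSolution 3 x' y' t') : Nonempty (A[T;T⁻¹] ≃ₐ[ℂ] B[T;T⁻¹]) := by
  have hTA : (T 1 * T (-1) : A[T;T⁻¹]) = 1 := T_one_mul_T_neg_one
  have hTB : (T 1 * T (-1) : B[T;T⁻¹]) = 1 := T_one_mul_T_neg_one
  have hA1 : (C t * (C x ^ 2 + C y ^ 5) : A[T;T⁻¹]) = 1 := by
    rw [← map_pow, ← map_pow, ← map_add, ← map_mul, ← pow_one t, hA.rel, map_one]
  have hB1 : (C t' ^ 3 * (C x' ^ 2 + C y' ^ 5) : B[T;T⁻¹]) = 1 := by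
    rw [← map_pow, ← map_pow, ← map_pow, ← map_add, ← map_mul, hB.rel, map_one]
  have hTA' (n : ℕ) : (T 1 * T (-1) : A[T;T⁻¹]) ^ n = 1 := by rw [hTA, one_pow]
  have hTB' (n : ℕ) : (T 1 * T (-1) : B[T;T⁻¹]) ^ n = 1 := by rw [hTB, one_pow]
  have hA' (n : ℕ) : (C t * (C x ^ 2 + C y ^ 5) : A[T;T⁻¹]) ^ n = 1 := by rw [hA1, one_pow]
  have hB' (n : ℕ) : (C t' ^ 3 * (C x' ^ 2 + C y' ^ 5) : B[T;T⁻¹]) ^ n = 1 := by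
    rw [hB1, one_pow]
  obtain ⟨f, hfx, hfy, hft⟩ := hA.exists_lift (C x' * T (-1) ^ 5 : B[T;T⁻¹]) (C y' * T (-1) ^ 2)
    (C t' ^ 3 * T 1 ^ 10) (by linear_combination (T 1 * T (-1)) ^ 10 * hB1 + hTB' 10)
  obtain ⟨g, hgx, hgy, hgt⟩ := hB.exists_lift
    (C x * ((C x ^ 2 + C y ^ 5) ^ 2 * T 1 ^ 3) ^ 5 : A[T;T⁻¹])
    (C y * ((C x ^ 2 + C y ^ 5) ^ 2 * T 1 ^ 3) ^ 2) (C t ^ 7 * T (-1) ^ 10)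
    (by linear_combination (T 1 * T (-1)) ^ 30 * hA' 21 + hTA' 30)
  let u : (B[T;T⁻¹])ˣ :=
    ⟨C t' ^ 2 * T 1 ^ 7, C t' * (C x' ^ 2 + C y' ^ 5) * T (-1) ^ 7,
      by linear_combination (T 1 * T (-1)) ^ 7 * hB1 + hTB' 7,
      by linear_combination (T 1 * T (-1)) ^ 7 * hB1 + hTB' 7⟩
  let v : (A[T;T⁻¹])ˣ :=
    ⟨(C x ^ 2 + C y ^ 5) ^ 2 * T 1 ^ 3, C t ^ 2 * T (-1) ^ 3,
      by linear_combination (T 1 * T (-1)) ^ 3 * hA' 2 + hTA' 3,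
      by linear_combination (T 1 * T (-1)) ^ 3 * hA' 2 + hTA' 3⟩
  refine ⟨AlgEquiv.ofAlgHom (liftAlgHom f u) (liftAlgHom g v) ?_ ?_⟩
  · apply hB.laurent_algHom_ext <;>
    simp only [AlgHom.comp_apply, AlgHom.id_apply, liftAlgHom_C, liftAlgHom_T_one,
      liftAlgHom_T_neg_one, hfx, hfy, hft, hgx, hgy, hgt, map_mul, map_pow, map_add, u, v,
      Units.inv_mk]
    · linear_combination C x' * ((T 1 * T (-1)) ^ 105 * hB' 10 + hTB' 105)
    · linear_combination C y' * ((T 1 * T (-1)) ^ 42 * hB' 4 + hTB' 42)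
    · linear_combination C t' * ((T 1 * T (-1)) ^ 70 * hB' 10 + hTB' 70)
    · linear_combination T 1 * ((T 1 * T (-1)) ^ 20 * hB' 2 + hTB' 20)
  · apply hA.laurent_algHom_ext <;>
    simp only [AlgHom.comp_apply, AlgHom.id_apply, liftAlgHom_C, liftAlgHom_T_one,
      liftAlgHom_T_neg_one, hfx, hfy, hft, hgx, hgy, hgt, map_mul, map_pow, u, v,
      Units.inv_mk]
    · linear_combination C x * ((T 1 * T (-1)) ^ 15 * hA' 10 + hTA' 15)
    · linear_combination C y * ((T 1 * T (-1)) ^ 6 * hA' 4 + hTA' 6)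
    · linear_combination C t * ((T 1 * T (-1)) ^ 30 * hA' 20 + hTA' 30)
    · linear_combination T 1 * ((T 1 * T (-1)) ^ 20 * hA' 14 + hTA' 20)

end Laurent

end IsUniversalSolution


/-- The coordinate ring `R[y][ω]`, `ω² = a - y⁵`, of the affine curve `x² + y⁵ = a` over `R`. -/
abbrev QuinticCurve {R : Type*} [CommRing R] (a : R) : Type _ :=
  QuadraticAlgebra (Polynomial R) (Polynomial.C a - Polynomial.X ^ 5) 0

namespace QuinticCurve

open Polynomial

variable {R : Type*} [CommRing R] {a : R}

/-- The pole order at infinity, computed as the degree of the norm. -/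
noncomputable def pole (z : QuinticCurve a) : WithBot ℕ := (QuadraticAlgebra.norm z).degree

theorem omega_sq_add_X_pow_five :
    (QuadraticAlgebra.omega ^ 2 + algebraMap R[X] _ X ^ 5 : QuinticCurve a) =
      algebraMap R[X] _ (C a) := by
  rw [pow_two, QuadraticAlgebra.omega_mul_omega_eq_mk, ← map_pow, QuadraticAlgebra.algebraMap_eq,
    QuadraticAlgebra.algebraMap_eq]
  ext <;> simp

theorem pole_neg (z : QuinticCurve a) : pole (-z) = pole z := by
  rw [pole, QuadraticAlgebra.norm_neg, pole]

theorem pole_zero : pole (0 : QuinticCurve a) = ⊥ := by simp [pole]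

theorem exists_pole_eq_natCast {z : QuinticCurve a} (h : pole z ≠ ⊥) : ∃ n : ℕ, pole z = n :=
  (WithBot.ne_bot_iff_exists.1 h).imp fun _ hn => hn.symm

theorem apply_eq {S : Type*} [Semiring S] (f : QuinticCurve a →+* S) (z : QuinticCurve a) :
    f z = f (algebraMap R[X] _ z.re) + f (algebraMap R[X] _ z.im) * f QuadraticAlgebra.omega := by
  conv_lhs => rw [← QuadraticAlgebra.mk_eta z, QuadraticAlgebra.mk_eq_add_smul_omega,
    Algebra.smul_def, map_add, map_mul]

variable [IsDomain R]

theorem pole_eq (z : QuinticCurve a) :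
    pole z = max (z.re.degree + z.re.degree) (5 + (z.im.degree + z.im.degree)) := by
  have hn : QuadraticAlgebra.norm z = z.re * z.re + (X ^ 5 - C a) * (z.im * z.im) := by
    rw [QuadraticAlgebra.norm_def]; ring
  have h5 : ((X ^ 5 - C a) * (z.im * z.im)).degree = 5 + (z.im.degree + z.im.degree) := by
    rw [degree_mul, degree_mul, degree_X_pow_sub_C (by norm_num)]; rfl
  have hne : (z.re * z.re).degree = ((X ^ 5 - C a) * (z.im * z.im)).degree →
      z.re = 0 ∧ z.im = 0 := by
    intro h
    rw [h5, degree_mul] at h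
    by_cases h1 : z.re = 0 <;> by_cases h2 : z.im = 0
    · exact ⟨h1, h2⟩
    · rw [h1, degree_eq_natDegree h2, degree_zero, WithBot.bot_add] at h
      exact absurd h (by norm_cast)
    · rw [h2, degree_eq_natDegree h1, degree_zero, WithBot.bot_add, WithBot.add_bot] at h
      exact absurd h (by norm_cast)
    · rw [degree_eq_natDegree h1, degree_eq_natDegree h2] at h
      norm_cast at h
      omega
  rw [pole, hn, ← degree_mul, ← h5]
  rcases lt_trichotomy (z.re * z.re).degree ((X ^ 5 - C a) * (z.im * z.im)).degree with h | h | h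
  · rw [degree_add_eq_right_of_degree_lt h, max_eq_right h.le]
  · obtain ⟨h1, h2⟩ := hne h
    simp [h1, h2]
  · rw [degree_add_eq_left_of_degree_lt h, max_eq_left h.le]

theorem pole_mul (z w : QuinticCurve a) : pole (z * w) = pole z + pole w := by
  rw [pole, map_mul, degree_mul, pole, pole]

theorem pole_pow (z : QuinticCurve a) (n : ℕ) : pole (z ^ n) = n • pole z := by
  rw [pole, map_pow, degree_pow, pole]

theorem pole_add_le (z w : QuinticCurve a) : pole (z + w) ≤ max (pole z) (pole w) := by
  have hre : (z + w).re.degree ≤ max z.re.degree w.re.degree := degree_add_le _ _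
  have him : (z + w).im.degree ≤ max z.im.degree w.im.degree := degree_add_le _ _
  rw [pole_eq, pole_eq z, pole_eq w]
  refine max_le ?_ ?_
  · rcases le_max_iff.1 hre with h | h
    · exact (add_le_add h h).trans ((le_max_left _ _).trans (le_max_left _ _))
    · exact (add_le_add h h).trans ((le_max_left _ _).trans (le_max_right _ _))
  · rcases le_max_iff.1 him with h | h
    · exact (add_le_add le_rfl (add_le_add h h)).trans
        ((le_max_right _ _).trans (le_max_left _ _))
    · exact (add_le_add le_rfl (add_le_add h h)).trans
        ((le_max_right _ _).trans (le_max_right _ _))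

theorem pole_add_eq_left {z w : QuinticCurve a} (h : pole w < pole z) :
    pole (z + w) = pole z := by
  refine le_antisymm ((pole_add_le z w).trans (max_le le_rfl h.le)) ?_
  by_contra! hlt
  have := pole_add_le (z + w) (-w)
  rw [add_neg_cancel_right, pole_neg] at this
  exact (max_lt hlt h).not_ge this

theorem pole_add_eq_max {z w : QuinticCurve a} (h : pole z ≠ pole w) :
    pole (z + w) = max (pole z) (pole w) := by
  rcases h.lt_or_gt with h | h
  · rw [add_comm, pole_add_eq_left h, max_eq_right h.le]
  · rw [pole_add_eq_left h, max_eq_left h.le]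

/-- The elements without a pole at infinity are the constants. -/
theorem exists_eq_algebraMap_of_pole_le_zero {z : QuinticCurve a} (h : pole z ≤ 0) :
    ∃ r : R, z = algebraMap R[X] (QuinticCurve a) (C r) := by
  rw [pole_eq, max_le_iff] at h
  obtain ⟨h1, h2⟩ := h
  have him : z.im = 0 := by
    by_contra h0
    rw [degree_eq_natDegree h0] at h2
    norm_cast at h2
    omega
  have hre : z.re.degree ≤ 0 := by
    by_cases h0 : z.re = 0
    · simp [h0]
    rw [degree_eq_natDegree h0] at h1 ⊢
    norm_cast at h1 ⊢
    omega
  exact ⟨z.re.coeff 0, QuadraticAlgebra.ext (eq_C_of_degree_le_zero hre) him⟩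

theorem pole_algebraMap (p : R[X]) :
    pole (algebraMap R[X] (QuinticCurve a) p) = p.degree + p.degree := by
  simp [pole_eq]

theorem pole_eq_zero_of_isUnit {z : QuinticCurve a} (h : IsUnit z) : pole z = 0 :=
  degree_eq_zero_of_isUnit (h.map QuadraticAlgebra.norm)

theorem pole_map {R' : Type*} [CommRing R'] (h : R'[X] →+* QuinticCurve a)
    (hC : ∀ r : R', r ≠ 0 → pole (h (C r)) = 0) {d : ℕ} (hd : 0 < d) (hX : pole (h X) = d)
    {p : R'[X]} (hp : p ≠ 0) : pole (h p) = ↑(p.natDegree * d) := by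
  induction hn : p.natDegree using Nat.strong_induction_on generalizing p with
  | _ n ih =>
    subst hn
    have hlead : pole (h (C p.leadingCoeff * X ^ p.natDegree)) = ↑(p.natDegree * d) := by
      rw [map_mul, map_pow, pole_mul, pole_pow, hC _ (leadingCoeff_ne_zero.2 hp), hX, zero_add]
      simp
    rw [← p.eraseLead_add_C_mul_X_pow, map_add, p.eraseLead_add_C_mul_X_pow, add_comm,
      pole_add_eq_left, hlead]
    rw [hlead]
    by_cases h0 : p.eraseLead = 0
    · rw [h0, map_zero, pole_zero]
      exact WithBot.bot_lt_coe _
    · have hlt := natDegree_lt_natDegree h0 (degree_eraseLead_lt hp)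
      rw [ih _ hlt h0 rfl]
      exact_mod_cast Nat.mul_lt_mul_of_pos_right hlt hd

theorem pole_eq_of_sq_add_pow_five {z w : QuinticCurve a} (h : pole (z ^ 2 + w ^ 5) = 0)
    (hw : 0 < pole w) : ∃ m : ℕ, 0 < m ∧ pole w = (m * 2 : ℕ) ∧ pole z = (m * 5 : ℕ) := by
  obtain ⟨n, hn⟩ := exists_pole_eq_natCast (bot_le.trans_lt hw).ne'
  rw [hn] at hw
  have hn0 : 0 < n := by exact_mod_cast hw
  have hw5 : pole (w ^ 5) = (5 * n : ℕ) := by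
    rw [pole_pow, hn, nsmul_eq_mul]; rfl
  have hzw : pole (z ^ 2) = pole (w ^ 5) := by
    by_contra hne
    have h5 : pole (w ^ 5) ≤ 0 := by
      rw [← h, pole_add_eq_max hne]
      exact le_max_right _ _
    rw [hw5] at h5
    have h5' : 5 * n ≤ 0 := by exact_mod_cast h5
    omega
  rw [hw5] at hzw
  have hz0 : pole z ≠ ⊥ := by
    intro h0
    rw [pow_two, pole_mul, h0, WithBot.bot_add] at hzw
    exact WithBot.bot_ne_natCast _ hzw
  obtain ⟨k, hk⟩ := exists_pole_eq_natCast hz0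
  replace hzw : 2 * k = 5 * n := by
    rw [pole_pow, hk, nsmul_eq_mul] at hzw
    exact Nat.cast_injective (R := WithBot ℕ) hzw
  refine ⟨n / 2, by omega, ?_, ?_⟩
  · rw [hn, Nat.div_mul_cancel (by omega)]
  · rw [hk]
    congr 1
    omega

section RingEquiv

variable {R' : Type*} [CommRing R'] {a' : R'}

/-- An isomorphism compatible with the constants maps the coordinates to functions with the same
poles. -/
theorem pole_ringEquiv (e : QuinticCurve a' ≃+* QuinticCurve a)
    (hC : ∀ r : R', r ≠ 0 → pole (e (algebraMap R'[X] _ (C r))) = 0)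
    (h : pole (e QuadraticAlgebra.omega ^ 2 + e (algebraMap R'[X] _ X) ^ 5) = 0) :
    pole (e (algebraMap R'[X] _ X)) = 2 ∧ pole (e QuadraticAlgebra.omega) = 5 := by
  set Y := e (algebraMap R'[X] _ X) with hY
  set Z := e QuadraticAlgebra.omega with hZ
  let f : R'[X] →+* QuinticCurve a :=
    (e : QuinticCurve a' →+* QuinticCurve a).comp (algebraMap _ _)
  obtain ⟨z, hz⟩ := e.surjective (algebraMap R[X] _ X)
  have hpz : pole (e z) = (2 : ℕ) := by rw [hz, pole_algebraMap, degree_X]; rfl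
  have hez : e z = f z.re + f z.im * Z := apply_eq (e : QuinticCurve a' →+* QuinticCurve a) z
  rcases le_or_gt (pole Y) 0 with hY0 | hY0
  · exfalso
    have hf (p : R'[X]) : pole (f p) ≤ 0 := by
      induction p using Polynomial.induction_on' with
      | add p q hp hq => rw [map_add]; exact (pole_add_le _ _).trans (max_le hp hq)
      | monomial n r =>
        rw [← C_mul_X_pow_eq_monomial, map_mul, map_pow, pole_mul, pole_pow]
        refine add_nonpos ?_ (nsmul_nonpos hY0 n)
        by_cases hr : r = 0
        · simp [hr, pole_zero]
        · exact (hC r hr).le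
    have hZ0 : pole Z ≤ 0 := by
      by_contra! hZ0
      have h2 : 0 < pole (Z ^ 2) := by
        rw [pole_pow]
        exact nsmul_pos hZ0 two_ne_zero
      have h5 : pole (Y ^ 5) ≤ 0 := by
        rw [pole_pow]
        exact nsmul_nonpos hY0 5
      rw [pole_add_eq_left (h5.trans_lt h2)] at h
      exact h2.ne' h
    have : pole (e z) ≤ 0 := by
      rw [hez]
      refine (pole_add_le _ _).trans (max_le (hf _) ?_)
      rw [pole_mul]
      exact add_nonpos (hf _) hZ0
    rw [hpz] at this
    exact absurd this (by decide)
  · obtain ⟨m, hm, hYm, hZm⟩ := pole_eq_of_sq_add_pow_five h hY0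
    have hf {p : R'[X]} (hp : p ≠ 0) : pole (f p) = ↑(p.natDegree * (m * 2)) :=
      pole_map f hC (by omega) hYm hp
    have hfZ {p : R'[X]} (hp : p ≠ 0) : pole (f p * Z) = ↑(p.natDegree * (m * 2) + m * 5) := by
      rw [pole_mul, hf hp, hZm]; rfl
    have hre : z.re ≠ 0 := by
      intro h0
      by_cases h1 : z.im = 0
      · rw [hez, h0, h1, map_zero, zero_mul, add_zero, pole_zero] at hpz
        exact absurd hpz (by simp)
      · rw [hez, h0, map_zero, zero_add, hfZ h1] at hpz
        have := Nat.cast_injective hpz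
        omega
    have him : z.im = 0 := by
      by_contra h1
      have hne : pole (f z.re) ≠ pole (f z.im * Z) := by
        rw [hf hre, hfZ h1]
        norm_cast
        intro heq
        have : m * (z.re.natDegree * 2) = m * (z.im.natDegree * 2 + 5) := by linarith
        have := Nat.eq_of_mul_eq_mul_left hm this
        omega
      have hle : pole (f z.im * Z) ≤ pole (e z) := by
        rw [hez, pole_add_eq_max hne]
        exact le_max_right _ _
      rw [hfZ h1, hpz] at hle
      have := Nat.cast_le.1 hle
      omega
    rw [hez, him, map_zero, zero_mul, add_zero, hf hre] at hpz
    replace hpz := Nat.cast_injective hpz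
    have hm1 : m = 1 := Nat.eq_one_of_mul_eq_one_left (m := z.re.natDegree) (by linarith)
    subst hm1
    exact ⟨hYm, hZm⟩

end RingEquiv

/-- If the leading terms of `z²` and `w⁵` cancel and `z² + w⁵` is a constant `r`, then `r` is `a` up
to a fifth power. -/
theorem exists_pow_five_mul_eq [CharZero R] {z w : QuinticCurve a} (hz : pole z = 5)
    (hw : pole w = 2) {r : R} (h : z ^ 2 + w ^ 5 = algebraMap R[X] _ (C r)) :
    ∃ b : R, b ^ 5 * a = r := by
  have hwim : w.im = 0 := by
    by_contra h0
    have := (le_max_right _ _).trans_eq ((pole_eq w).symm.trans hw)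
    rw [degree_eq_natDegree h0] at this
    norm_cast at this
    omega
  have hwre : w.re.degree ≤ 1 := by
    by_cases h0 : w.re = 0
    · simp [h0]
    have := (le_max_left _ _).trans_eq ((pole_eq w).symm.trans hw)
    rw [degree_eq_natDegree h0] at this ⊢
    norm_cast at this ⊢
    omega
  have hzim : z.im.degree ≤ 0 := by
    by_cases h0 : z.im = 0
    · simp [h0]
    have := (le_max_right _ _).trans_eq ((pole_eq z).symm.trans hz)
    rw [degree_eq_natDegree h0] at this ⊢
    norm_cast at this ⊢
    omega
  have hzim0 : z.im ≠ 0 := by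
    intro h0
    rw [pole_eq, h0] at hz
    by_cases h1 : z.re = 0
    · simp [h1] at hz
    rw [degree_eq_natDegree h1] at hz
    simp at hz
    norm_cast at hz
    omega
  have hw' : w = algebraMap R[X] _ w.re := QuadraticAlgebra.ext rfl hwim
  rw [hw', ← map_pow] at h
  have him := congrArg QuadraticAlgebra.im h
  have hre := congrArg QuadraticAlgebra.re h
  simp only [pow_two, QuadraticAlgebra.re_add, QuadraticAlgebra.im_add, QuadraticAlgebra.re_mul,
    QuadraticAlgebra.im_mul, QuadraticAlgebra.algebraMap_re, QuadraticAlgebra.algebraMap_im]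
    at him hre
  have hzre : z.re = 0 := by
    have h0 : z.re * z.im * 2 = 0 := by linear_combination him
    simpa [hzim0] using h0
  obtain ⟨α, hα⟩ : ∃ α, z.im = C α := ⟨_, eq_C_of_degree_le_zero hzim⟩
  obtain ⟨β, γ, hβγ⟩ : ∃ β γ, w.re = C β * X + C γ := ⟨_, _, eq_X_add_C_of_degree_le_one hwre⟩
  rw [hzre, hα, hβγ] at hre
  rw [hα, Ne, C_eq_zero] at hzim0
  have key : C (β ^ 5 - α ^ 2) * X ^ 5 + C (5 * β ^ 4 * γ) * X ^ 4 +
      C (10 * β ^ 3 * γ ^ 2) * X ^ 3 + C (10 * β ^ 2 * γ ^ 3) * X ^ 2 +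
      C (5 * β * γ ^ 4) * X + C (γ ^ 5 + α ^ 2 * a - r) = 0 := by
    simp only [map_sub, map_add, map_mul, map_pow, map_ofNat]
    linear_combination hre
  have hcoeff {c₅ c₄ c₃ c₂ c₁ c₀ : R}
      (hc : C c₅ * X ^ 5 + C c₄ * X ^ 4 + C c₃ * X ^ 3 + C c₂ * X ^ 2 + C c₁ * X + C c₀ = 0) :
      c₅ = 0 ∧ c₄ = 0 ∧ c₀ = 0 :=
    ⟨by simpa [coeff_X, coeff_C] using congrArg (coeff · 5) hc,
      by simpa [coeff_X, coeff_C] using congrArg (coeff · 4) hc,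
      by simpa [coeff_X, coeff_C] using congrArg (coeff · 0) hc⟩
  obtain ⟨h5, h4, h0⟩ := hcoeff key
  have hβ : β ≠ 0 := by
    rintro rfl
    exact hzim0 (by simpa using h5)
  have hγ : γ = 0 := by simpa [hβ] using h4
  exact ⟨β, by rw [hγ] at h0; linear_combination h0 + a * h5⟩

open scoped LaurentPolynomial

theorem exists_algHom {k R S : Type*} [CommRing k] [CommRing R] [CommRing S] [Algebra k R]
    [Algebra k S] {a : R} (P : R[X] →ₐ[k] S) {u : S} (hu : u ^ 2 = P (C a - X ^ 5)) :
    ∃ f : QuinticCurve a →ₐ[k] S,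
      (∀ p, f (algebraMap R[X] _ p) = P p) ∧ f QuadraticAlgebra.omega = u :=
  ⟨{  toFun z := P z.re + P z.im * u
      map_one' := by rw [QuadraticAlgebra.re_one, QuadraticAlgebra.im_one]; simp
      map_zero' := by simp
      map_add' z w := by
        simp only [QuadraticAlgebra.re_add, QuadraticAlgebra.im_add, map_add]
        ring
      map_mul' z w := by
        simp only [QuadraticAlgebra.re_mul, QuadraticAlgebra.im_mul, map_add, map_mul, map_zero,
          ← hu]
        ring
      commutes' r := by
        rw [Algebra.algebraMap_eq_smul_one]
        simp only [QuadraticAlgebra.re_smul, QuadraticAlgebra.im_smul, QuadraticAlgebra.re_one,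
          QuadraticAlgebra.im_one, smul_zero, map_zero, zero_mul, add_zero, map_smul, map_one,
          Algebra.algebraMap_eq_smul_one] },
    fun p => by simp, by simp⟩

theorem isUniversalSolution {ℓ : ℕ} (hℓ : ℓ ≠ 0) :
    IsUniversalSolution ℓ (A := QuinticCurve (LaurentPolynomial.T (-ℓ) : ℂ[T;T⁻¹]))
      QuadraticAlgebra.omega (algebraMap ℂ[T;T⁻¹][X] _ X)
      (algebraMap ℂ[T;T⁻¹][X] _ (C (LaurentPolynomial.T 1))) where
  rel := by
    rw [omega_sq_add_X_pow_five, ← map_pow, ← map_mul, ← map_pow, ← map_mul,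
      LaurentPolynomial.T_pow, ← LaurentPolynomial.T_add]
    simp
  exists_lift {S} _ _ a b c h := by
    obtain ⟨u, rfl⟩ := (isUnit_pow_iff hℓ).1 (IsUnit.of_mul_eq_one _ h)
    let G : ℂ[T;T⁻¹] →ₐ[ℂ] S := LaurentPolynomial.liftAlgHom (Algebra.ofId ℂ S) u
    have hG : G (LaurentPolynomial.T 1) = u := LaurentPolynomial.liftAlgHom_T_one _ u
    have hGℓ : G (LaurentPolynomial.T (-ℓ)) * u ^ ℓ = 1 := by
      rw [← hG, ← map_pow, ← map_mul, LaurentPolynomial.T_pow, ← LaurentPolynomial.T_add]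
      simp
    let P : ℂ[T;T⁻¹][X] →ₐ[ℂ] S := eval₂AlgHom G b fun _ => .all _ _
    have hPC (r : ℂ[T;T⁻¹]) : P (C r) = G r := eval₂_C (G : ℂ[T;T⁻¹] →+* S) b
    have hPX : P X = b := eval₂_X (G : ℂ[T;T⁻¹] →+* S) b
    obtain ⟨f, hf, hfω⟩ := exists_algHom (a := LaurentPolynomial.T (-ℓ)) P (u := a) (by
      rw [map_sub, map_pow, hPC, hPX]
      linear_combination G (LaurentPolynomial.T (-ℓ)) * h - (a ^ 2 + b ^ 5) * hGℓ)
    exact ⟨f, hfω, by rw [hf, hPX], by rw [hf, hPC, hG]⟩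
  hom_ext {S} _ _ f g hx hy ht := by
    let ι : ℂ[T;T⁻¹][X] →ₐ[ℂ] QuinticCurve (LaurentPolynomial.T (-ℓ) : ℂ[T;T⁻¹]) :=
      Algebra.algHom ℂ _ _
    have h : f.comp ι = g.comp ι := by
      refine Polynomial.algHom_ext' (LaurentPolynomial.algHom_ext_of_C_of_T (fun r => ?_) ht) hy
      exact (AlgHom.commutes (f.comp (ι.comp CAlgHom)) r).trans
        (AlgHom.commutes (g.comp (ι.comp CAlgHom)) r).symm
    refine AlgHom.ext fun z => ?_
    have hf := apply_eq (f : _ →+* S) z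
    have hg := apply_eq (g : _ →+* S) z
    have h1 := DFunLike.congr_fun h z.re
    have h2 := DFunLike.congr_fun h z.im
    exact hf.trans ((congrArg₂ (· + ·) h1 (congrArg₂ (· * ·) h2 hx)).trans hg.symm)

end QuinticCurve

theorem IsUniversalSolution.nonempty_algEquiv {ℓ : ℕ} {A B : Type} [CommRing A] [Algebra ℂ A]
    [CommRing B] [Algebra ℂ B] {x y t : A} {x' y' t' : B} (hA : IsUniversalSolution ℓ x y t)
    (hB : IsUniversalSolution ℓ x' y' t') : Nonempty (A ≃ₐ[ℂ] B) := by
  obtain ⟨f, hfx, hfy, hft⟩ := hA.exists_lift x' y' t' hB.rel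
  obtain ⟨g, hgx, hgy, hgt⟩ := hB.exists_lift x y t hA.rel
  refine ⟨AlgEquiv.ofAlgHom f g (hB.hom_ext ?_ ?_ ?_) (hA.hom_ext ?_ ?_ ?_)⟩ <;>
    simp [hfx, hfy, hft, hgx, hgy, hgt]

namespace LaurentPolynomial

open scoped LaurentPolynomial

theorem T_ne_zero {R : Type*} [Semiring R] [Nontrivial R] (n : ℤ) : (T n : R[T;T⁻¹]) ≠ 0 :=
  (isUnit_T n).ne_zero

variable {K : Type*} [Field K]

theorem eq_of_C_mul_T_eq {c d : K} {m n : ℤ} (hc : c ≠ 0) (h : C c * T m = C d * T n) : m = n := by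
  have hd : d ≠ 0 := by
    rintro rfl
    rw [map_zero, zero_mul] at h
    simpa [hc] using congrArg degree h
  have := congrArg degree h
  rw [degree_C_mul_T m c hc, degree_C_mul_T n d hd] at this
  exact_mod_cast this

theorem isUnit_C_mul_T {c : K} (hc : c ≠ 0) (n : ℤ) : IsUnit (C c * T n : K[T;T⁻¹]) :=
  (hc.isUnit.map C).mul (isUnit_T n)

theorem exists_eq_C_mul_T_of_isUnit {p : K[T;T⁻¹]} (h : IsUnit p) :
    ∃ (c : K) (n : ℤ), c ≠ 0 ∧ p = C c * T n := by
  obtain ⟨q, hq⟩ := h.exists_right_inv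
  obtain ⟨m, f, hf⟩ := exists_T_pow p
  obtain ⟨n, g, hg⟩ := exists_T_pow q
  have hfg : f * g = Polynomial.X ^ (m + n) := by
    apply Polynomial.toLaurent_injective
    rw [map_mul, hf, hg, Polynomial.toLaurent_X_pow, Nat.cast_add, T_add]
    linear_combination T m * T n * hq
  obtain ⟨i, -, hi⟩ := (dvd_prime_pow Polynomial.prime_X _).1 (Dvd.intro g hfg)
  obtain ⟨u, hu⟩ := hi.symm
  obtain ⟨c, hc, hcu⟩ := Polynomial.isUnit_iff.1 u.isUnit
  refine ⟨c, i - m, hc.ne_zero, ?_⟩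
  rw [← hcu] at hu
  have hT : (T m * T (-m) : K[T;T⁻¹]) = 1 := by rw [← T_add]; simp
  have hp : p * T m = T i * C c := by
    rw [← hf, ← hu, map_mul, Polynomial.toLaurent_X_pow, Polynomial.toLaurent_C]
  rw [sub_eq_add_neg, T_add]
  linear_combination T (-m) * hp - p * hT

/-- An automorphism of the torus maps the coordinate to a multiple of it or of its inverse. -/
theorem exists_algEquiv_T_one (φ : K[T;T⁻¹] ≃ₐ[K] K[T;T⁻¹]) :
    ∃ (c : K) (k : ℤ), c ≠ 0 ∧ IsUnit k ∧ φ (T 1) = C c * T k := by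
  obtain ⟨c, k, hc, hk⟩ := exists_eq_C_mul_T_of_isUnit ((isUnit_T 1).map φ)
  obtain ⟨d, m, hd, hm⟩ := exists_eq_C_mul_T_of_isUnit ((isUnit_T 1).map φ.symm)
  refine ⟨c, k, hc, ?_, hk⟩
  have hφC : φ (C d) = C d := by simpa using φ.commutes d
  have hφT (n : ℕ) : φ (T n) = C (c ^ n) * T (n * k) := by
    have hn : (T n : K[T;T⁻¹]) = T 1 ^ n := by rw [T_pow, mul_one]
    rw [hn, map_pow, hk, mul_pow, T_pow, map_pow]
  have h1 : T 1 = C d * φ (T m) := by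
    rw [← hφC, ← map_mul, ← hm, AlgEquiv.apply_symm_apply]
  obtain ⟨n, rfl | rfl⟩ := m.eq_nat_or_neg
  · have h2 : C 1 * T 1 = C (d * c ^ n) * T (n * k) := by
      rw [map_one, one_mul, map_mul, mul_assoc, ← hφT, h1]
    exact IsUnit.of_mul_eq_one_right _ (eq_of_C_mul_T_eq one_ne_zero h2).symm
  · have hT : φ (T n) * φ (T (-n)) = 1 := by
      rw [← map_mul, ← T_add, add_neg_cancel, T_zero, map_one]
    have h2 : C (c ^ n) * T (n * k + 1) = C d * T 0 := by
      rw [T_add, T_zero, ← mul_assoc, ← hφT, h1]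
      linear_combination C d * hT
    have h3 := eq_of_C_mul_T_eq (pow_ne_zero n hc) h2
    exact IsUnit.of_mul_eq_one_right (-n : ℤ) (by linear_combination -h3)

end LaurentPolynomial

namespace QuinticCurve

open Polynomial
open scoped LaurentPolynomial

section Const

variable {K R : Type*} [CommRing K] [CommRing R] [Algebra K R]

/-- The inclusion of the constants. -/
noncomputable def const (a : R) : R →ₐ[K] QuinticCurve a :=
  (Algebra.algHom K R[X] (QuinticCurve a)).comp CAlgHom

theorem const_apply (a r : R) : const (K := K) a r = algebraMap R[X] _ (C r) := rfl

theorem const_injective (a : R) : Function.Injective (const (K := K) a) :=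
  QuadraticAlgebra.algebraMap_injective.comp C_injective

end Const

variable {K : Type*} [Field K]

/-- Since Laurent polynomials are sums of units, constants are mapped to constants. -/
theorem exists_algHom_apply_const {a a' : K[T;T⁻¹]} (e : QuinticCurve a →ₐ[K] QuinticCurve a') :
    ∃ φ : K[T;T⁻¹] →ₐ[K] K[T;T⁻¹], ∀ r, e (const (K := K) a r) = const (K := K) a' (φ r) := by
  have hrange (r : K[T;T⁻¹]) : (e.comp (const a)) r ∈ (const (K := K) a').range := by
    induction r using LaurentPolynomial.induction_on' with
    | add p q hp hq => rw [map_add]; exact add_mem hp hq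
    | C_mul_T n c =>
      by_cases hc : c = 0
      · rw [hc, map_zero, zero_mul, map_zero]; exact zero_mem _
      · obtain ⟨l, hl⟩ := exists_eq_algebraMap_of_pole_le_zero (pole_eq_zero_of_isUnit
          ((LaurentPolynomial.isUnit_C_mul_T hc n).map (e.comp (const a)))).le
        exact ⟨l, hl.symm⟩
  let ι := AlgEquiv.ofInjective (const (K := K) a') (const_injective a')
  refine ⟨(ι.symm : _ →ₐ[K] K[T;T⁻¹]).comp ((e.comp (const a)).codRestrict _ hrange), fun r => ?_⟩
  exact (congrArg Subtype.val (ι.apply_symm_apply ((e.comp (const a)).codRestrict _ hrange r))).symm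

theorem exists_algEquiv_apply_const {a a' : K[T;T⁻¹]}
    (e : QuinticCurve a ≃ₐ[K] QuinticCurve a') :
    ∃ φ : K[T;T⁻¹] ≃ₐ[K] K[T;T⁻¹], ∀ r, e (const (K := K) a r) = const (K := K) a' (φ r) := by
  obtain ⟨φ, hφ⟩ := exists_algHom_apply_const (e : QuinticCurve a →ₐ[K] QuinticCurve a')
  obtain ⟨ψ, hψ⟩ := exists_algHom_apply_const
    (e.symm : QuinticCurve a' →ₐ[K] QuinticCurve a)
  simp only [AlgEquiv.coe_toAlgHom] at hφ hψ
  refine ⟨AlgEquiv.ofAlgHom φ ψ (AlgHom.ext fun r => ?_) (AlgHom.ext fun r => ?_), hφ⟩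
  · apply const_injective (K := K) a'
    rw [AlgHom.comp_apply, ← hφ, ← hψ, AlgEquiv.apply_symm_apply, AlgHom.id_apply]
  · apply const_injective (K := K) a
    rw [AlgHom.comp_apply, ← hψ, ← hφ, AlgEquiv.symm_apply_apply, AlgHom.id_apply]

theorem pole_const {a r : K[T;T⁻¹]} (hr : r ≠ 0) : pole (const (K := K) a r) = 0 := by
  rw [const_apply, pole_algebraMap, degree_C hr, add_zero]

theorem exists_pow_five_mul_eq_apply [CharZero K] {a a' : K[T;T⁻¹]} (ha : a ≠ 0)
    (e : QuinticCurve a ≃ₐ[K] QuinticCurve a') (φ : K[T;T⁻¹] ≃ₐ[K] K[T;T⁻¹])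
    (hφ : ∀ r, e (const (K := K) a r) = const (K := K) a' (φ r)) : ∃ b, b ^ 5 * a' = φ a := by
  have hrel : e QuadraticAlgebra.omega ^ 2 + e (algebraMap K[T;T⁻¹][X] _ X) ^ 5 =
      const (K := K) a' (φ a) := by
    rw [← map_pow, ← map_pow, ← map_add, omega_sq_add_X_pow_five]
    exact hφ a
  have hpole {r : K[T;T⁻¹]} (hr : r ≠ 0) : pole (const (K := K) a' (φ r)) = 0 :=
    pole_const (φ.map_ne_zero_iff.2 hr)
  obtain ⟨hX, hω⟩ := pole_ringEquiv (e : QuinticCurve a ≃+* QuinticCurve a')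
    (fun r hr => (congrArg pole (hφ r)).trans (hpole hr))
    ((congrArg pole hrel).trans (hpole ha))
  have : CharZero K[T;T⁻¹] :=
    charZero_of_injective_algebraMap (algebraMap K K[T;T⁻¹]).injective
  exact exists_pow_five_mul_eq hω hX hrel

theorem isEmpty_algEquiv [CharZero K] :
    IsEmpty (QuinticCurve (LaurentPolynomial.T (-1) : K[T;T⁻¹]) ≃ₐ[K]
      QuinticCurve (LaurentPolynomial.T (-3) : K[T;T⁻¹])) := by
  refine ⟨fun e => ?_⟩
  obtain ⟨φ, hφ⟩ := exists_algEquiv_apply_const e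
  obtain ⟨b, hb⟩ := exists_pow_five_mul_eq_apply (LaurentPolynomial.T_ne_zero _) e φ hφ
  obtain ⟨c, k, hc, hk, hφT⟩ := LaurentPolynomial.exists_algEquiv_T_one φ
  have h1 : b ^ 5 * (LaurentPolynomial.T (-3) * (LaurentPolynomial.C c * LaurentPolynomial.T k)) =
      1 := by
    rw [← hφT, ← mul_assoc, hb, ← map_mul, mul_comm, LaurentPolynomial.T_one_mul_T_neg_one,
      map_one]
  obtain ⟨β, n, hβ, rfl⟩ := LaurentPolynomial.exists_eq_C_mul_T_of_isUnit
    ((isUnit_pow_iff (by norm_num)).1 (IsUnit.of_mul_eq_one _ h1))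
  have h2 : LaurentPolynomial.C (β ^ 5 * c) * LaurentPolynomial.T (5 * n + (-3) + k) =
      LaurentPolynomial.C 1 * LaurentPolynomial.T 0 := by
    rw [LaurentPolynomial.T_zero, map_one, mul_one, ← h1, LaurentPolynomial.T_add,
      LaurentPolynomial.T_add, map_mul, map_pow, mul_pow, LaurentPolynomial.T_pow]
    push_cast
    ring
  have h3 := LaurentPolynomial.eq_of_C_mul_T_eq (mul_ne_zero (pow_ne_zero 5 hβ) hc) h2
  rcases Int.isUnit_iff.1 hk with rfl | rfl <;> omega

end QuinticCurve

/-- **Proposition (counterexample to Laurent Cancellation).** The surfaces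
`X₁ = {t(x² + y⁵) = 1}` and `X₃ = {t³(x² + y⁵) = 1}` in `𝔸³` are not isomorphic,
although their `ℂ*`-cylinders are: the `ℂ`-algebras `A₁` and `A₃` are not isomorphic,
but `A₁[u,u⁻¹]` and `A₃[u,u⁻¹]` are isomorphic. -/
theorem case25_laurent_cancellation_fails :
    (¬ Nonempty (surfaceRing25 1 ≃ₐ[ℂ] surfaceRing25 3)) ∧
    Nonempty (LaurentPolynomial (surfaceRing25 1) ≃ₐ[ℂ]
      LaurentPolynomial (surfaceRing25 3)) := by
  refine ⟨fun ⟨e⟩ => ?_, (surfaceRing25_isUniversalSolution 1).nonempty_laurent_algEquiv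
    (surfaceRing25_isUniversalSolution 3)⟩
  obtain ⟨f⟩ := (QuinticCurve.isUniversalSolution one_ne_zero).nonempty_algEquiv
    (surfaceRing25_isUniversalSolution 1)
  obtain ⟨g⟩ := (surfaceRing25_isUniversalSolution 3).nonempty_algEquiv
    (QuinticCurve.isUniversalSolution three_ne_zero)
  exact QuinticCurve.isEmpty_algEquiv.false ((f.trans e).trans g)
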